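/- arXiv:2104.04581 — 3 statements merged into one kernel-verified Lean document; each statement's English description precedes it below -/
import Mathlib

section
/- Fix T > 0 and γ > 0, and let α : [0,T] → ℝ be continuous. Assume |α(0)| ≤ exp(−γT) and, for all t ∈ [0,T], |α(t)| ≤ |α(0)| + ∫₀ᵗ γ·(|α(s)|² + |α(s)|) ds. Then for all t ∈ [0,T], |α(t)| ≤ |α(0)| / (−|α(0)| + (|α(0)|+1)·exp(−γt)), and this quantity is at most |α(0)|·exp(2γT). -/
open Set in
/-- If `u ≥ 0` is continuous and `u t ≤ a + ∫ s in 0..t, γ * (u s ^ 2 + u s)`, then `u` is bounded by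
the solution of the logistic-type equation `y' = γ * (y ^ 2 + y)`, `y 0 = a`, in a form cleared of
denominators. -/
theorem mul_le_of_le_add_integral_quadratic {T γ a : ℝ} (hγ : 0 ≤ γ) (ha : 0 ≤ a) {u : ℝ → ℝ}
    (hu : Continuous u) (hu0 : ∀ t, 0 ≤ u t)
    (h : ∀ t ∈ Icc (0 : ℝ) T, u t ≤ a + ∫ s in (0 : ℝ)..t, γ * (u s ^ 2 + u s))
    {t : ℝ} (ht : t ∈ Icc (0 : ℝ) T) :
    u t * (-a + (a + 1) * Real.exp (-(γ * t))) ≤ a := by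
  set F : ℝ → ℝ := fun t => a + ∫ s in (0 : ℝ)..t, γ * (u s ^ 2 + u s) with hF
  have hF_deriv (x : ℝ) : HasDerivAt F (γ * (u x ^ 2 + u x)) x :=
    (Continuous.integral_hasStrictDerivAt (by fun_prop) 0 x).hasDerivAt.const_add a
  have hF_nonneg : ∀ x ∈ Icc (0 : ℝ) T, 0 ≤ F x := fun x hx => (hu0 x).trans (h x hx)
  have hG_deriv : ∀ x ∈ Icc (0 : ℝ) T, HasDerivAt
      (fun x => F x / (F x + 1) * Real.exp (-(γ * x)))
      (Real.exp (-(γ * x)) / (F x + 1) ^ 2 * (γ * (u x ^ 2 + u x) - γ * (F x ^ 2 + F x))) x := by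
    intro x hx
    have hpos : F x + 1 ≠ 0 := by linarith [hF_nonneg x hx]
    have hexp : HasDerivAt (fun x => Real.exp (-(γ * x))) (Real.exp (-(γ * x)) * -(γ * 1)) x :=
      (((hasDerivAt_id x).const_mul γ).neg).exp
    refine (((hF_deriv x).div ((hF_deriv x).add_const 1) hpos).mul hexp).congr_deriv ?_
    simp only [Pi.div_apply]
    field_simp
    ring
  have hG : AntitoneOn (fun x => F x / (F x + 1) * Real.exp (-(γ * x))) (Icc 0 T) := by
    refine antitoneOn_of_hasDerivWithinAt_nonpos (convex_Icc 0 T)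
      (fun x hx => (hG_deriv x hx).continuousAt.continuousWithinAt)
      (fun x hx => (hG_deriv x (interior_subset hx)).hasDerivWithinAt) fun x hx => ?_
    have hx := interior_subset hx
    refine mul_nonpos_of_nonneg_of_nonpos (by positivity) (sub_nonpos.2 ?_)
    have := hu0 x
    have : u x ≤ F x := h x hx
    gcongr
  have hle := hG ⟨le_rfl, ht.1.trans ht.2⟩ ht ht.1
  have hF_zero : F 0 = a := by simp [hF]
  have hFt := hF_nonneg t ht
  simp only [hF_zero, mul_zero, neg_zero, Real.exp_zero, mul_one] at hle
  rw [div_mul_eq_mul_div, div_le_div_iff₀ (by linarith) (by linarith)] at hle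
  have huF : u t ≤ F t := h t ht
  rcases le_total 0 (-a + (a + 1) * Real.exp (-(γ * t))) with hD | hD
  · calc
      _ ≤ F t * (-a + (a + 1) * Real.exp (-(γ * t))) := by gcongr
      _ ≤ a := by linarith
  · exact (mul_nonpos_of_nonneg_of_nonpos (hu0 t) hD).trans ha


/-- Lemma 1 of the paper: Gronwall-type comparison for an integral
inequality with quadratic right-hand side. -/
theorem gronwall_quadratic (T γ : ℝ) (hT : 0 < T) (hγ : 0 < γ) (α : ℝ → ℝ)
    (hcont : ContinuousOn α (Set.Icc 0 T))
    (h0 : |α 0| ≤ Real.exp (-(γ * T)))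
    (hineq : ∀ t ∈ Set.Icc (0:ℝ) T,
      |α t| ≤ |α 0| + ∫ s in (0:ℝ)..t, γ * (|α s| ^ 2 + |α s|)) :
    ∀ t ∈ Set.Icc (0:ℝ) T,
      |α t| ≤ |α 0| / (-|α 0| + (|α 0| + 1) * Real.exp (-(γ * t))) ∧
      |α 0| / (-|α 0| + (|α 0| + 1) * Real.exp (-(γ * t))) ≤
        |α 0| * Real.exp (2 * γ * T) := by
  intro t ht
  have ha := abs_nonneg (α 0)
  have hE := Real.exp_pos (-(γ * T))
  have hET : Real.exp (-(γ * T)) ≤ Real.exp (-(γ * t)) := by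
    have := ht.2
    gcongr
  have he1 : Real.exp (-(γ * t)) ≤ 1 :=
    Real.exp_le_one_iff.2 (neg_nonpos.2 (mul_nonneg hγ.le ht.1))
  have hD : Real.exp (-(γ * T)) ^ 2 ≤ -|α 0| + (|α 0| + 1) * Real.exp (-(γ * t)) := by
    nlinarith [mul_le_mul_of_nonneg_right h0 (sub_nonneg.2 he1)]
  have hDpos := (pow_pos hE 2).trans_le hD
  constructor
  · rw [le_div_iff₀ hDpos]
    set u : ℝ → ℝ := fun s => |Set.IccExtend hT.le ((Set.Icc 0 T).domRestrict α) s| with hu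
    have hu_eq : ∀ s ∈ Set.Icc 0 T, u s = |α s| := fun s hs => by
      simp [hu, Set.IccExtend_of_mem _ _ hs]
    rw [← hu_eq t ht]
    refine mul_le_of_le_add_integral_quadratic (u := u) hγ.le ha (hcont.domRestrict.Icc_extend').abs
      (fun s => abs_nonneg _) (fun x hx => ?_) ht
    rw [hu_eq x hx]
    refine (hineq x hx).trans_eq (congrArg _ (intervalIntegral.integral_congr fun s hs => ?_))
    rw [Set.uIcc_of_le hx.1] at hs
    simp only [hu_eq s ⟨hs.1, hs.2.trans hx.2⟩]
  · rw [div_le_iff₀ hDpos, mul_assoc]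
    refine le_mul_of_one_le_right ha ?_
    calc
      1 = Real.exp (2 * γ * T) * Real.exp (-(γ * T)) ^ 2 := by
        rw [← Real.exp_nat_mul, ← Real.exp_add, eq_comm, Real.exp_eq_one_iff]
        push_cast
        ring
      _ ≤ _ := by gcongr
end

section
/- Let γ > 0 and 0 < δ̄ ≤ exp(2γ). Suppose φ : [0,1] → ℝ is continuous and satisfies φ(x) = exp(−4γ)·δ̄ + ∫ₓ¹ 2γ·(φ(ξ) + φ(ξ)²) dξ for all x ∈ [0,1]. Then exp(−4γ)·δ̄ ≤ φ(x) ≤ δ̄ for all x ∈ [0,1]; in particular φ(0) ≤ δ̄ and φ(x) ≥ φ(1) for every x ∈ [0,1]. -/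
/-- A solution of the backward Cauchy problem `f' = -(a * f)`, `a` continuous, with positive
terminal value is positive. -/
theorem pos_of_hasDerivAt_neg_mul_of_pos_right {f a : ℝ → ℝ} (ha : Continuous a)
    (hf : ∀ x ∈ Set.Icc (0:ℝ) 1, HasDerivAt f (-(a x * f x)) x) (h1 : 0 < f 1) :
    ∀ x ∈ Set.Icc (0:ℝ) 1, 0 < f x := by
  have hE : ∀ x, HasDerivAt (fun y => Real.exp (∫ ξ in (0:ℝ)..y, a ξ))
      (Real.exp (∫ ξ in (0:ℝ)..x, a ξ) * a x) x := fun x =>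
    (intervalIntegral.integral_hasDerivAt_right (ha.intervalIntegrable _ _)
      (ha.stronglyMeasurableAtFilter _ _) ha.continuousAt).exp
  have hG : ∀ x ∈ Set.Icc (0:ℝ) 1,
      HasDerivAt (fun y => f y * Real.exp (∫ ξ in (0:ℝ)..y, a ξ)) 0 x := fun x hx =>
    ((hf x hx).mul (hE x)).congr_deriv (by ring)
  have hconst := constant_of_has_deriv_right_zero
    (fun x hx => (hG x hx).continuousAt.continuousWithinAt)
    (fun x hx => (hG x (Set.Ico_subset_Icc_self hx)).hasDerivWithinAt)
  intro x hx
  have h := (hconst x hx).trans (hconst 1 (Set.right_mem_Icc.2 zero_le_one)).symm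
  have hpos : 0 < f x * Real.exp (∫ ξ in (0:ℝ)..x, a ξ) := by
    rw [h]; exact mul_pos h1 (Real.exp_pos _)
  exact pos_of_mul_pos_left hpos (Real.exp_pos _).le

/-- A positive solution of `f' = -k (f + f ^ 2)` satisfies the conservation law that
`f / (1 + f) * exp (k x)` is constant. -/
theorem div_one_add_mul_exp_eq_of_hasDerivAt {f : ℝ → ℝ} {k : ℝ}
    (hf : ∀ x ∈ Set.Icc (0:ℝ) 1, HasDerivAt f (-(k * (f x + f x ^ 2))) x)
    (hpos : ∀ x ∈ Set.Icc (0:ℝ) 1, 0 < f x) :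
    ∀ x ∈ Set.Icc (0:ℝ) 1,
      f x / (1 + f x) * Real.exp (k * x) = f 1 / (1 + f 1) * Real.exp k := by
  have hG : ∀ x ∈ Set.Icc (0:ℝ) 1,
      HasDerivAt (fun y => f y / (1 + f y) * Real.exp (k * y)) 0 x := fun x hx => by
    have hne : 1 + f x ≠ 0 := by linarith [hpos x hx]
    have hE : HasDerivAt (fun y => Real.exp (k * y)) (Real.exp (k * x) * (k * 1)) x :=
      ((hasDerivAt_id x).const_mul k).exp
    refine (((hf x hx).div ((hf x hx).const_add 1) hne).mul hE).congr_deriv ?_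
    rw [Pi.div_apply]
    field_simp
    ring
  have hconst := constant_of_has_deriv_right_zero
    (fun x hx => (hG x hx).continuousAt.continuousWithinAt)
    (fun x hx => (hG x (Set.Ico_subset_Icc_self hx)).hasDerivWithinAt)
  intro x hx
  simpa using (hconst x hx).trans (hconst 1 (Set.right_mem_Icc.2 zero_le_one)).symm

/-- Bounds on the comparison function φ from the proof of the paper's Lemma 3. -/
theorem comparison_function_bounds (γ δbar : ℝ) (hγ : 0 < γ) (hδ0 : 0 < δbar)
    (hδ : δbar ≤ Real.exp (2 * γ))
    (φ : ℝ → ℝ) (hcont : ContinuousOn φ (Set.Icc 0 1))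
    (heq : ∀ x ∈ Set.Icc (0:ℝ) 1,
      φ x = Real.exp (-(4 * γ)) * δbar + ∫ ξ in x..(1:ℝ), 2 * γ * (φ ξ + (φ ξ) ^ 2)) :
    (∀ x ∈ Set.Icc (0:ℝ) 1, Real.exp (-(4 * γ)) * δbar ≤ φ x ∧ φ x ≤ δbar) ∧
    φ 0 ≤ δbar ∧ (∀ x ∈ Set.Icc (0:ℝ) 1, φ 1 ≤ φ x) := by
  have hmem0 : (0:ℝ) ∈ Set.Icc (0:ℝ) 1 := Set.left_mem_Icc.2 zero_le_one
  have hmem1 : (1:ℝ) ∈ Set.Icc (0:ℝ) 1 := Set.right_mem_Icc.2 zero_le_one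
  have hφ1 : φ 1 = Real.exp (-(4 * γ)) * δbar := by simpa using heq 1 hmem1
  have hφ1pos : 0 < φ 1 := by rw [hφ1]; positivity
  -- Extend `φ` continuously to `ψ` on the line, and let `F` be the integral expression in `ψ`.
  obtain ⟨ψ, hψ, hψφ⟩ : ∃ ψ : ℝ → ℝ, Continuous ψ ∧ ∀ x ∈ Set.Icc (0:ℝ) 1, ψ x = φ x :=
    ⟨Set.IccExtend zero_le_one ((Set.Icc (0:ℝ) 1).domRestrict φ),
      (continuousOn_iff_continuous_domRestrict.1 hcont).Icc_extend',
      fun x hx => Set.IccExtend_of_mem _ _ hx⟩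
  obtain ⟨F, hF⟩ : ∃ F : ℝ → ℝ, ∀ x,
      F x = φ 1 + ∫ ξ in x..(1:ℝ), 2 * γ * (ψ ξ + (ψ ξ) ^ 2) := ⟨_, fun _ => rfl⟩
  have hFφ : ∀ x ∈ Set.Icc (0:ℝ) 1, F x = φ x := fun x hx => by
    rw [hF, heq x hx, hφ1]
    congr 1
    refine intervalIntegral.integral_congr fun ξ hξ => ?_
    rw [Set.uIcc_of_le hx.2] at hξ
    simp only [hψφ ξ ⟨hx.1.trans hξ.1, hξ.2⟩]
  have hF' : ∀ x ∈ Set.Icc (0:ℝ) 1, HasDerivAt F (-(2 * γ * (F x + F x ^ 2))) x := by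
    intro x hx
    have hc : Continuous fun ξ => 2 * γ * (ψ ξ + (ψ ξ) ^ 2) := by fun_prop
    rw [hFφ x hx, ← hψφ x hx, funext hF]
    exact (intervalIntegral.integral_hasDerivAt_left (hc.intervalIntegrable _ _)
      (hc.stronglyMeasurableAtFilter _ _) hc.continuousAt).const_add _
  have hFpos : ∀ x ∈ Set.Icc (0:ℝ) 1, 0 < F x := by
    refine pos_of_hasDerivAt_neg_mul_of_pos_right (a := fun x => 2 * γ * (1 + ψ x))
      (by fun_prop) (fun x hx => (hF' x hx).congr_deriv ?_) (by rwa [hFφ 1 hmem1])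
    rw [hψφ x hx, hFφ x hx]
    ring
  have hlower : ∀ x ∈ Set.Icc (0:ℝ) 1, φ 1 ≤ φ x := by
    intro x hx
    rw [heq x hx, hφ1]
    refine le_add_of_nonneg_right (intervalIntegral.integral_nonneg hx.2 fun ξ hξ => ?_)
    have hξ' : ξ ∈ Set.Icc (0:ℝ) 1 := ⟨hx.1.trans hξ.1, hξ.2⟩
    have : 0 < φ ξ := hFφ ξ hξ' ▸ hFpos ξ hξ'
    positivity
  have hupper : ∀ x ∈ Set.Icc (0:ℝ) 1, φ x ≤ δbar := by
    intro x hx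
    have hy : 0 < φ x := hFφ x hx ▸ hFpos x hx
    have hcons := div_one_add_mul_exp_eq_of_hasDerivAt hF' hFpos x hx
    rw [hFφ x hx, hFφ 1 hmem1] at hcons
    have hu : 1 ≤ Real.exp (2 * γ * x) :=
      Real.one_le_exp (mul_nonneg (by positivity) hx.1)
    have hM : 1 ≤ Real.exp (2 * γ) := Real.one_le_exp (by positivity)
    have hδM : δbar = φ 1 * Real.exp (2 * γ) ^ 2 := by
      rw [hφ1, sq, ← Real.exp_add, mul_right_comm, ← Real.exp_add]
      ring_nf
      simp
    generalize Real.exp (2 * γ * x) = u at hu hcons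
    generalize Real.exp (2 * γ) = M at hM hδM hδ hcons
    generalize φ x = y at hy hcons ⊢
    generalize φ 1 = c at hφ1pos hδM hcons
    have hcM : c * M ≤ 1 := by
      rw [hδM] at hδ
      by_contra! h
      nlinarith
    have hcons' : y * u * (1 + c) = c * M * (1 + y) := by
      field_simp at hcons
      linarith
    have hle : y * (1 + c - c * M) ≤ c * M := by
      nlinarith [mul_nonneg (mul_nonneg hy.le (sub_nonneg.2 hu)) (by linarith : 0 ≤ 1 + c)]
    have hge : c * M ≤ c * M ^ 2 * (1 + c - c * M) := by
      have : 0 ≤ c * M * ((M - 1) * (1 - c * M)) :=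
        mul_nonneg (by positivity) (mul_nonneg (by linarith) (by linarith))
      nlinarith
    rw [hδM]
    exact le_of_mul_le_mul_right (hle.trans hge) (by linarith)
  exact ⟨fun x hx => ⟨hφ1 ▸ hlower x hx, hupper x hx⟩, hupper 0 hmem0, hlower⟩
end

section
/- Let γ > 0 and c ≥ 0. Suppose φ : [0,1] → ℝ is continuous, nonnegative, and satisfies φ(x) = c + ∫ₓ¹ 2γ·(φ(ξ) + φ(ξ)²) dξ for all x ∈ [0,1], and suppose β : [0,1] → ℝ is continuous and satisfies |β(x)| ≤ c + ∫ₓ¹ γ·(φ(ξ)·|β(ξ)| + β(ξ)² + φ(ξ) + |β(ξ)|) dξ for all x ∈ [0,1]. Then |β(x)| ≤ φ(x) for all x ∈ [0,1]; in particular |β(0)| ≤ φ(0). -/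
open Set MeasureTheory in
/-- Backward integral Grönwall inequality with zero terminal value. -/
theorem nonpos_of_le_mul_integral {a b M : ℝ} {u : ℝ → ℝ}
    (huc : ContinuousOn u (Icc a b)) (hM : 0 ≤ M)
    (hu : ∀ x ∈ Icc a b, u x ≤ M * ∫ ξ in x..b, u ξ) :
    ∀ x ∈ Icc a b, u x ≤ 0 := by
  intro x hx
  have hab : a ≤ b := hx.1.trans hx.2
  have hd : ∀ y ∈ Ioo a b, HasDerivAt (fun y ↦ Real.exp (M * y) * ∫ ξ in y..b, u ξ)
      (Real.exp (M * y) * (M * (∫ ξ in y..b, u ξ) - u y)) y := by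
    intro y hy
    have hI : HasDerivAt (fun y ↦ ∫ ξ in y..b, u ξ) (-u y) y :=
      intervalIntegral.integral_hasDerivAt_left
        ((huc.mono (Icc_subset_Icc_left hy.1.le)).intervalIntegrable_of_Icc hy.2.le)
        ((huc.mono Ioo_subset_Icc_self).stronglyMeasurableAtFilter isOpen_Ioo y hy)
        (huc.continuousAt (Icc_mem_nhds hy.1 hy.2))
    have hE : HasDerivAt (fun y ↦ Real.exp (M * y)) (Real.exp (M * y) * M) y := by
      simpa using ((hasDerivAt_id y).const_mul M).exp
    exact (hE.mul hI).congr_deriv (by ring)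
  have hmono : MonotoneOn (fun y ↦ Real.exp (M * y) * ∫ ξ in y..b, u ξ) (Icc a b) := by
    refine monotoneOn_of_deriv_nonneg (convex_Icc a b) ?_ ?_ ?_
    · refine ContinuousOn.mul (by fun_prop) ?_
      have := intervalIntegral.continuousOn_primitive_interval_left (μ := volume)
        (f := u) (a := a) (b := b)
        (by rw [uIcc_of_le hab]; exact huc.integrableOn_Icc)
      rwa [uIcc_of_le hab] at this
    · rw [interior_Icc]
      exact fun y hy ↦ (hd y hy).differentiableAt.differentiableWithinAt
    · rw [interior_Icc]
      intro y hy
      rw [(hd y hy).deriv]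
      exact mul_nonneg (Real.exp_pos _).le (sub_nonneg.2 (hu y (Ioo_subset_Icc_self hy)))
  have hle := hmono hx (right_mem_Icc.2 hab) hx.2
  simp only [intervalIntegral.integral_same, mul_zero] at hle
  exact (hu x hx).trans
    (mul_nonpos_of_nonneg_of_nonpos hM (nonpos_of_mul_nonpos_right hle (Real.exp_pos _)))


/-- The comparison step in the proof of the paper's Lemma 3 (Appendix B.2). -/
theorem comparison_step (γ c : ℝ) (hγ : 0 < γ) (hc : 0 ≤ c)
    (φ β : ℝ → ℝ)
    (hφc : ContinuousOn φ (Set.Icc 0 1))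
    (hφ0 : ∀ x ∈ Set.Icc (0:ℝ) 1, 0 ≤ φ x)
    (hφ : ∀ x ∈ Set.Icc (0:ℝ) 1,
      φ x = c + ∫ ξ in x..(1:ℝ), 2 * γ * (φ ξ + (φ ξ) ^ 2))
    (hβc : ContinuousOn β (Set.Icc 0 1))
    (hβ : ∀ x ∈ Set.Icc (0:ℝ) 1,
      |β x| ≤ c + ∫ ξ in x..(1:ℝ),
        γ * (φ ξ * |β ξ| + (β ξ) ^ 2 + φ ξ + |β ξ|)) :
    (∀ x ∈ Set.Icc (0:ℝ) 1, |β x| ≤ φ x) ∧ |β 0| ≤ φ 0 := by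
  suffices h : ∀ x ∈ Set.Icc (0:ℝ) 1, |β x| ≤ φ x from ⟨h, h 0 (by simp)⟩
  have hb : ContinuousOn (fun x ↦ |β x|) (Set.Icc 0 1) := hβc.abs
  have hD : ContinuousOn (fun x ↦ max (|β x| - φ x) 0) (Set.Icc 0 1) :=
    (hb.sub hφc).sup continuousOn_const
  obtain ⟨K, hK⟩ := isCompact_Icc.bddAbove_image
    (show ContinuousOn (fun x ↦ 1 + |β x| + 2 * φ x) (Set.Icc 0 1) by fun_prop)
  replace hK : ∀ x ∈ Set.Icc (0:ℝ) 1, 1 + |β x| + 2 * φ x ≤ K :=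
    fun x hx ↦ hK (Set.mem_image_of_mem _ hx)
  have hK0 : 0 ≤ K := by
    have h0 : (0:ℝ) ∈ Set.Icc (0:ℝ) 1 := by simp
    linarith [hK 0 h0, hφ0 0 h0, abs_nonneg (β 0)]
  have hpos := nonpos_of_le_mul_integral hD (mul_nonneg hγ.le hK0) fun x hx ↦ by
    have hsub : Set.Icc x 1 ⊆ Set.Icc 0 1 := Set.Icc_subset_Icc_left hx.1
    have hint {f : ℝ → ℝ} (hf : ContinuousOn f (Set.Icc 0 1)) :
        IntervalIntegrable f MeasureTheory.volume x 1 :=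
      (hf.mono hsub).intervalIntegrable_of_Icc hx.2
    have hiβ := hint (f := fun ξ ↦ γ * (φ ξ * |β ξ| + (β ξ) ^ 2 + φ ξ + |β ξ|)) (by fun_prop)
    have hiφ := hint (f := fun ξ ↦ 2 * γ * (φ ξ + (φ ξ) ^ 2)) (by fun_prop)
    have hle : (∫ ξ in x..(1:ℝ), (γ * (φ ξ * |β ξ| + (β ξ) ^ 2 + φ ξ + |β ξ|)
        - 2 * γ * (φ ξ + (φ ξ) ^ 2))) ≤ ∫ ξ in x..(1:ℝ), γ * K * max (|β ξ| - φ ξ) 0 := by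
      refine intervalIntegral.integral_mono_on hx.2 (hiβ.sub hiφ)
        ((hint hD).const_mul _) fun ξ hξ ↦ ?_
      have hw : 0 ≤ 1 + |β ξ| + 2 * φ ξ := by
        linarith [hφ0 ξ (hsub hξ), abs_nonneg (β ξ)]
      calc _ = γ * ((1 + |β ξ| + 2 * φ ξ) * (|β ξ| - φ ξ)) := by
            rw [← sq_abs (β ξ)]; ring
        _ ≤ γ * (K * max (|β ξ| - φ ξ) 0) := by
            refine mul_le_mul_of_nonneg_left ?_ hγ.le
            exact (mul_le_mul_of_nonneg_left (le_max_left _ 0) hw).trans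
              (mul_le_mul_of_nonneg_right (hK ξ (hsub hξ)) (le_max_right _ _))
        _ = _ := by ring
    rw [intervalIntegral.integral_sub hiβ hiφ, intervalIntegral.integral_const_mul (γ * K)] at hle
    refine max_le (by linarith [hφ x hx, hβ x hx]) (mul_nonneg (mul_nonneg hγ.le hK0) ?_)
    exact intervalIntegral.integral_nonneg hx.2 fun ξ _ ↦ le_max_right _ _
  exact fun x hx ↦ sub_nonpos.1 ((le_max_left _ _).trans (hpos x hx))
end
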